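/- Under the PS&W setup, suppose g̃ : (0,∞) → [0,∞) is a measurable probability density satisfying ∫₀^∞ w^p g̃(w) dw < ∞ and ∫₀^∞ e^{−c²w/2} g̃(w) dw = 1/cosh(c/2) for every c ∈ ℝ. Define the Markov transition density k(β̃, β) = ∫_{(0,∞)ⁿ} π(β | w, y) π(w | β̃, y) dw, the iterated kernels k^{(1)} = k and k^{(r)}(β̃, β) = ∫_{ℝ^p} k^{(r−1)}(β̃, β*) k(β*, β) dβ* for r ≥ 2, and, given a probability density q₀ on ℝ^p with ∫_{ℝ^p} exp( (1/2) ∑_{i=1}^n |u_iᵀβ| ) q₀(β) dβ < ∞, the marginal densities q_j(β) = ∫_{ℝ^p} k(β̃, β) q_{j−1}(β̃) dβ̃ for j ≥ 1. Then there exists a finite constant C* such that for all integers 0 ≤ j < j′: ∫_{ℝ^p} ∫_{ℝ^p} [ ∫_{(0,∞)ⁿ} ( π(β | w, y) / π(β | y) )² π(w | β̃, y) dw ] · q_j(β̃) · k^{(j′−j)}(β̃, β) dβ̃ dβ ≤ C*. -/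

import Mathlib

open Matrix MeasureTheory
open scoped ENNReal

/-- The precision matrix `UᵀΩ(w)U + B⁻¹` of the conditional Gaussian in the PS&W sampler. -/
noncomputable def pswPrec {n p : ℕ} (U : Matrix (Fin n) (Fin p) ℝ)
    (B : Matrix (Fin p) (Fin p) ℝ) (w : Fin n → ℝ) : Matrix (Fin p) (Fin p) ℝ :=
  Uᵀ * Matrix.diagonal w * U + B⁻¹

/-- The vector `μ = Uᵀ(y − ½1ₙ) + B⁻¹b` in the PS&W setup. -/
noncomputable def pswMu {n p : ℕ} (U : Matrix (Fin n) (Fin p) ℝ)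
    (B : Matrix (Fin p) (Fin p) ℝ) (b : Fin p → ℝ) (y : Fin n → ℝ) : Fin p → ℝ :=
  Uᵀ *ᵥ (fun i => y i - 1/2) + B⁻¹ *ᵥ b

/-- The `N_p(Σ(w)μ, Σ(w))` density `π(β | w, y)` of the PS&W Gibbs sampler. -/
noncomputable def pswNormalDensity {n p : ℕ} (U : Matrix (Fin n) (Fin p) ℝ)
    (B : Matrix (Fin p) (Fin p) ℝ) (b : Fin p → ℝ) (y : Fin n → ℝ)
    (β : Fin p → ℝ) (w : Fin n → ℝ) : ℝ :=
  (2 * Real.pi) ^ (-(p : ℝ) / 2) * (pswPrec U B w).det ^ ((1 : ℝ) / 2) *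
    Real.exp (-(1/2) * ((β - (pswPrec U B w)⁻¹ *ᵥ pswMu U B b y) ⬝ᵥ
      (pswPrec U B w) *ᵥ (β - (pswPrec U B w)⁻¹ *ᵥ pswMu U B b y)))

/-- The conditional density `π(w | β, y) = ∏ᵢ cosh(uᵢᵀβ/2) exp(−(1/2)(uᵢᵀβ)² wᵢ) g̃(wᵢ)`
of the latent Polya–Gamma variables in the PS&W sampler. -/
noncomputable def pswPGDensity {n p : ℕ} (U : Matrix (Fin n) (Fin p) ℝ)
    (gt : ℝ → ℝ) (w : Fin n → ℝ) (β : Fin p → ℝ) : ℝ :=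
  ∏ i, (Real.cosh ((U *ᵥ β) i / 2) * Real.exp (-(1/2) * ((U *ᵥ β) i) ^ 2 * w i) * gt (w i))

/-- The standard logistic distribution function `F(t) = eᵗ/(1+eᵗ)`. -/
noncomputable def logisticF (t : ℝ) : ℝ := Real.exp t / (1 + Real.exp t)

/-- The `N_p(b, B)` prior density for `β`. -/
noncomputable def pswPrior {p : ℕ} (B : Matrix (Fin p) (Fin p) ℝ) (b : Fin p → ℝ)
    (β : Fin p → ℝ) : ℝ :=
  (2 * Real.pi) ^ (-(p : ℝ) / 2) * B.det ^ (-(1 : ℝ) / 2) *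
    Real.exp (-(1/2) * ((β - b) ⬝ᵥ B⁻¹ *ᵥ (β - b)))

/-- The logistic regression likelihood `∏ᵢ F(uᵢᵀβ)^{yᵢ} (1 − F(uᵢᵀβ))^{1−yᵢ}`. -/
noncomputable def pswLik {n p : ℕ} (U : Matrix (Fin n) (Fin p) ℝ) (y : Fin n → ℝ)
    (β : Fin p → ℝ) : ℝ :=
  ∏ i, (logisticF ((U *ᵥ β) i)) ^ (y i) * (1 - logisticF ((U *ᵥ β) i)) ^ (1 - y i)

/-- Lebesgue measure on `(0,∞)ⁿ`, as a measure on `Fin n → ℝ`. -/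
noncomputable def pswWMeasure (n : ℕ) : Measure (Fin n → ℝ) :=
  Measure.pi fun _ : Fin n => (volume : Measure ℝ).restrict (Set.Ioi (0 : ℝ))

theorem lintegral_ofReal_fintype_prod {ι : Type*} [Fintype ι] {μ : Measure ℝ} [SigmaFinite μ]
    {f : ι → ℝ → ℝ} (hf : ∀ i, Integrable (f i) μ) (hf0 : ∀ i, 0 ≤ᵐ[μ] f i) :
    ∫⁻ w, ENNReal.ofReal (∏ i, f i (w i)) ∂(Measure.pi fun _ : ι => μ)
      = ENNReal.ofReal (∏ i, ∫ x, f i x ∂μ) := by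
  rw [← integral_fintype_prod_eq_prod (μ := fun _ : ι => μ) f]
  refine (ofReal_integral_eq_lintegral_ofReal (Integrable.fintype_prod hf) ?_).symm
  have h : ∀ᵐ w ∂(Measure.pi fun _ : ι => μ), ∀ i, 0 ≤ f i (w i) :=
    ae_all_iff.2 fun i =>
      (Measure.tendsto_eval_ae_ae (μ := fun _ : ι => μ) (i := i)).eventually (hf0 i)
  filter_upwards [h] with w hw
  exact Finset.prod_nonneg fun i _ => hw i

theorem lintegral_exp_neg_half_quadratic {p : ℕ} {P : Matrix (Fin p) (Fin p) ℝ}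
    (hP : P.PosDef) :
    ∫⁻ x : Fin p → ℝ, ENNReal.ofReal (Real.exp (-(1/2) * (x ⬝ᵥ P *ᵥ x)))
      = ENNReal.ofReal ((2 * Real.pi) ^ ((p : ℝ) / 2) * P.det ^ (-(1 : ℝ) / 2)) := by
  obtain ⟨A, rfl⟩ : ∃ A : Matrix (Fin p) (Fin p) ℝ, P = Aᴴ * A := by
    open scoped MatrixOrder in
    obtain ⟨A, hA⟩ := CStarAlgebra.nonneg_iff_eq_star_mul_self.1 hP.posSemidef.nonneg
    exact ⟨A, hA⟩
  have hdet : (Aᴴ * A).det = A.det ^ 2 := by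
    rw [conjTranspose_eq_transpose_of_trivial, det_mul, det_transpose, sq]
  have hA : A.det ≠ 0 := by
    intro h
    have := hP.det_pos
    rw [hdet, h] at this
    simp at this
  have hquad (x : Fin p → ℝ) : x ⬝ᵥ (Aᴴ * A) *ᵥ x = ∑ i, (toLin' A x) i ^ 2 := by
    rw [← mulVec_mulVec, conjTranspose_eq_transpose_of_trivial, dotProduct_mulVec,
      vecMul_transpose]
    simp [dotProduct, sq]
  have hexp (x : Fin p → ℝ) :
      Real.exp (-(1/2) * ∑ i, x i ^ 2) = ∏ i, Real.exp (-(1/2) * (x i) ^ 2) := by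
    rw [Finset.mul_sum, Real.exp_sum]
  have hmeas : Measurable fun x : Fin p → ℝ => ENNReal.ofReal (∏ i, Real.exp (-(1/2) * x i ^ 2)) := by
    fun_prop
  have h1 := lintegral_ofReal_fintype_prod (ι := Fin p) (μ := volume)
    (f := fun _ x => Real.exp (-(1/2) * x ^ 2))
    (fun _ => integrable_exp_neg_mul_sq (by norm_num))
    (fun _ => Filter.Eventually.of_forall fun _ => (Real.exp_pos _).le)
  simp_rw [hquad, hexp]
  rw [← lintegral_map (f := fun x : Fin p → ℝ => ENNReal.ofReal (∏ i, Real.exp (-(1/2) * x i ^ 2)))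
    (g := toLin' A) hmeas (toLin' A).continuous_of_finiteDimensional.measurable,
    Real.map_matrix_volume_pi_eq_smul_volume_pi hA, lintegral_smul_measure, volume_pi, h1,
    smul_eq_mul, ← ENNReal.ofReal_mul (abs_nonneg _), integral_gaussian, hdet,
    Finset.prod_const, Finset.card_univ, Fintype.card_fin]
  congr 1
  have h2 : (√(Real.pi / (1/2))) ^ p = (2 * Real.pi) ^ ((p : ℝ) / 2) := by
    rw [Real.sqrt_eq_rpow, ← Real.rpow_natCast, ← Real.rpow_mul (by positivity)]
    congr 1 <;> ring
  have h3 : (A.det ^ 2) ^ (-(1 : ℝ) / 2) = |A.det⁻¹| := by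
    rw [← sq_abs, ← Real.rpow_natCast, ← Real.rpow_mul (abs_nonneg _), abs_inv]
    norm_num
    rw [Real.rpow_neg_one]
  rw [h2, h3, mul_comm]

theorem dotProduct_mulVec_comm_of_isHermitian {p : ℕ} {P : Matrix (Fin p) (Fin p) ℝ}
    (hP : P.IsHermitian) (x z : Fin p → ℝ) : x ⬝ᵥ P *ᵥ z = z ⬝ᵥ P *ᵥ x := by
  rw [dotProduct_mulVec, ← mulVec_transpose, dotProduct_comm]
  congr 2

theorem lintegral_exp_dotProduct_mul_gaussian {p : ℕ} {P : Matrix (Fin p) (Fin p) ℝ}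
    (hP : P.PosDef) (a m : Fin p → ℝ) :
    ∫⁻ x : Fin p → ℝ, ENNReal.ofReal (Real.exp (a ⬝ᵥ x) *
      ((2 * Real.pi) ^ (-(p : ℝ) / 2) * P.det ^ ((1 : ℝ) / 2) *
        Real.exp (-(1/2) * ((x - m) ⬝ᵥ P *ᵥ (x - m)))))
      = ENNReal.ofReal (Real.exp (a ⬝ᵥ m + 1/2 * (a ⬝ᵥ P⁻¹ *ᵥ a))) := by
  have hdet := hP.det_pos
  set s := P⁻¹ *ᵥ a with hs
  have hPs : P *ᵥ s = a := by
    rw [hs, mulVec_mulVec, mul_nonsing_inv _ hdet.ne'.isUnit, one_mulVec]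
  have key (x : Fin p → ℝ) : Real.exp (a ⬝ᵥ x) *
      ((2 * Real.pi) ^ (-(p : ℝ) / 2) * P.det ^ ((1 : ℝ) / 2) *
        Real.exp (-(1/2) * ((x - m) ⬝ᵥ P *ᵥ (x - m)))) =
      (Real.exp (a ⬝ᵥ m + 1/2 * (a ⬝ᵥ s)) *
      ((2 * Real.pi) ^ (-(p : ℝ) / 2) * P.det ^ ((1 : ℝ) / 2))) *
        Real.exp (-(1/2) * ((x - (m + s)) ⬝ᵥ P *ᵥ (x - (m + s)))) := by
    have e : a ⬝ᵥ x + -(1/2) * ((x - m) ⬝ᵥ P *ᵥ (x - m)) = a ⬝ᵥ m + 1/2 * (a ⬝ᵥ s) +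
        -(1/2) * ((x - (m + s)) ⬝ᵥ P *ᵥ (x - (m + s))) := by
      have h1 : x - (m + s) = (x - m) - s := by abel
      have h2 := dotProduct_mulVec_comm_of_isHermitian hP.1 s (x - m)
      rw [hPs] at h2
      rw [h1, mulVec_sub P (x - m) s, sub_dotProduct (x - m) s, dotProduct_sub (x - m),
        dotProduct_sub s, h2, hPs, dotProduct_comm s a, dotProduct_comm (x - m) a,
        dotProduct_sub a]
      ring
    calc _ = ((2 * Real.pi) ^ (-(p : ℝ) / 2) * P.det ^ ((1 : ℝ) / 2)) *
        Real.exp (a ⬝ᵥ x + -(1/2) * ((x - m) ⬝ᵥ P *ᵥ (x - m))) := by rw [Real.exp_add]; ring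
      _ = _ := by rw [e, Real.exp_add]; ring
  simp_rw [key]
  have hc : 0 ≤ Real.exp (a ⬝ᵥ m + 1/2 * (a ⬝ᵥ s)) *
      ((2 * Real.pi) ^ (-(p : ℝ) / 2) * P.det ^ ((1 : ℝ) / 2)) := by positivity
  simp_rw [ENNReal.ofReal_mul hc]
  rw [lintegral_const_mul' _ _ ENNReal.ofReal_ne_top,
    lintegral_sub_right_eq_self (fun x : Fin p → ℝ =>
      ENNReal.ofReal (Real.exp (-(1/2) * (x ⬝ᵥ P *ᵥ x)))) (m + s),
    lintegral_exp_neg_half_quadratic hP, ← ENNReal.ofReal_mul hc]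
  congr 1
  have h2 : (2 * Real.pi) ^ (-(p : ℝ) / 2) * (2 * Real.pi) ^ ((p : ℝ) / 2) = 1 := by
    rw [← Real.rpow_add (by positivity)]; ring_nf; simp
  have h3 : P.det ^ ((1 : ℝ) / 2) * P.det ^ (-(1 : ℝ) / 2) = 1 := by
    rw [← Real.rpow_add hdet]; norm_num
  calc _ = Real.exp (a ⬝ᵥ m + 1/2 * (a ⬝ᵥ s)) *
      ((2 * Real.pi) ^ (-(p : ℝ) / 2) * (2 * Real.pi) ^ ((p : ℝ) / 2)) *
      (P.det ^ ((1 : ℝ) / 2) * P.det ^ (-(1 : ℝ) / 2)) := by ring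
    _ = _ := by rw [h2, h3]; ring

/-- Completing the square: `2⟨a, z⟩ - ⟨z, Pz⟩ ≤ ⟨a, P⁻¹a⟩`. -/
theorem two_mul_dotProduct_sub_le {p : ℕ} {P : Matrix (Fin p) (Fin p) ℝ}
    (hP : P.PosDef) (a z : Fin p → ℝ) :
    2 * (a ⬝ᵥ z) - z ⬝ᵥ P *ᵥ z ≤ a ⬝ᵥ P⁻¹ *ᵥ a := by
  have hPs : P *ᵥ (P⁻¹ *ᵥ a) = a := by
    rw [mulVec_mulVec, mul_nonsing_inv _ hP.det_pos.ne'.isUnit, one_mulVec]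
  have h := hP.posSemidef.dotProduct_mulVec_nonneg (z - P⁻¹ *ᵥ a)
  have h2 := dotProduct_mulVec_comm_of_isHermitian hP.1 (P⁻¹ *ᵥ a) z
  rw [star_trivial, mulVec_sub, sub_dotProduct, dotProduct_sub, dotProduct_sub, h2, hPs,
    dotProduct_comm _ a, dotProduct_comm _ a] at h
  linarith

theorem dotProduct_inv_mulVec_anti {p : ℕ} {P Q : Matrix (Fin p) (Fin p) ℝ}
    (hP : P.PosDef) (hQ : Q.PosDef) (hQP : ∀ x, x ⬝ᵥ Q *ᵥ x ≤ x ⬝ᵥ P *ᵥ x) (a : Fin p → ℝ) :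
    a ⬝ᵥ P⁻¹ *ᵥ a ≤ a ⬝ᵥ Q⁻¹ *ᵥ a := by
  have hPs : P *ᵥ (P⁻¹ *ᵥ a) = a := by
    rw [mulVec_mulVec, mul_nonsing_inv _ hP.det_pos.ne'.isUnit, one_mulVec]
  have h1 := two_mul_dotProduct_sub_le hQ a (P⁻¹ *ᵥ a)
  have h2 := hQP (P⁻¹ *ᵥ a)
  rw [hPs, dotProduct_comm _ a] at h2
  linarith

/-- Polarized comparison `2⟨a, P⁻¹m⟩ ≤ ⟨a, P⁻¹a⟩ + ⟨m, P⁻¹m⟩`. -/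
theorem two_mul_dotProduct_inv_mulVec_le {p : ℕ} {P : Matrix (Fin p) (Fin p) ℝ}
    (hP : P.PosDef) (a m : Fin p → ℝ) :
    2 * (a ⬝ᵥ P⁻¹ *ᵥ m) ≤ a ⬝ᵥ P⁻¹ *ᵥ a + m ⬝ᵥ P⁻¹ *ᵥ m := by
  have hPs : P *ᵥ (P⁻¹ *ᵥ m) = m := by
    rw [mulVec_mulVec, mul_nonsing_inv _ hP.det_pos.ne'.isUnit, one_mulVec]
  have h1 := two_mul_dotProduct_sub_le hP a (P⁻¹ *ᵥ m)
  rw [hPs, dotProduct_comm _ m] at h1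
  linarith

/-- The bound on a two-time functional of a Markov chain with transition density `k`: a functional
`D` dominated by a product `C * H x * h z` has uniformly bounded integrals against the joint
densities, when `h` has uniformly bounded one-step means. -/
theorem markov_lintegral_two_time_le {X : Type*} [MeasurableSpace X] {μ : Measure X} [SFinite μ]
    {k : X → X → ℝ≥0∞} (hk : Measurable (Function.uncurry k))
    {kiter : ℕ → X → X → ℝ≥0∞} (hkiter_one : kiter 1 = k)
    (hkiter_succ : ∀ r : ℕ, 2 ≤ r → ∀ x z,
      kiter r x z = ∫⁻ s, kiter (r - 1) x s * k s z ∂μ)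
    {q : ℕ → X → ℝ≥0∞} (hq_zero : Measurable (q 0))
    (hq_succ : ∀ j z, q (j + 1) z = ∫⁻ x, k x z * q j x ∂μ)
    {h H : X → ℝ≥0∞} (hh : Measurable h) (hH : Measurable H) (hHh : ∀ x, H x ≤ h x)
    {M M₀ C : ℝ≥0∞} (hk_one : ∀ x, ∫⁻ z, k x z ∂μ ≤ 1) (hkh : ∀ x, ∫⁻ z, h z * k x z ∂μ ≤ M)
    (hq_one : ∫⁻ x, q 0 x ∂μ ≤ 1) (hqH : ∫⁻ x, H x * q 0 x ∂μ ≤ M₀)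
    {D : X → X → ℝ≥0∞} (hD : ∀ x z, D x z ≤ C * H x * h z) {j j' : ℕ} (hj : j < j') :
    ∫⁻ z, ∫⁻ x, D x z * q j x * kiter (j' - j) x z ∂μ ∂μ ≤ C * (M * max M M₀) := by
  have hkiter_meas : ∀ r, Measurable (Function.uncurry (kiter (r + 1))) := by
    intro r
    induction r with
    | zero => simpa [hkiter_one] using hk
    | succ r ih =>
      have e : Function.uncurry (kiter (r + 1 + 1)) =
          fun xz : X × X => ∫⁻ s, kiter (r + 1) xz.1 s * k s xz.2 ∂μ := by
        ext xz
        exact hkiter_succ (r + 1 + 1) (by omega) xz.1 xz.2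
      rw [e]
      refine Measurable.lintegral_prod_right'
        (f := fun a : (X × X) × X => kiter (r + 1) a.1.1 a.2 * k a.2 a.1.2) ?_
      exact (ih.comp (measurable_fst.fst.prodMk measurable_snd)).mul
        (hk.comp (measurable_snd.prodMk measurable_fst.snd))
  have hq_meas : ∀ i, Measurable (q i) := by
    intro i
    induction i with
    | zero => exact hq_zero
    | succ i ih =>
      have e : q (i + 1) = fun z => ∫⁻ x, k x z * q i x ∂μ := funext (hq_succ i)
      rw [e]
      refine Measurable.lintegral_prod_right' (f := fun a : X × X => k a.2 a.1 * q i a.2) ?_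
      exact (hk.comp measurable_swap).mul (ih.comp measurable_snd)
  have hq_step (g : X → ℝ≥0∞) (hg : Measurable g) (L : ℝ≥0∞)
      (hL : ∀ x, ∫⁻ z, g z * k x z ∂μ ≤ L) (i : ℕ) :
      ∫⁻ z, g z * q (i + 1) z ∂μ ≤ L * ∫⁻ x, q i x ∂μ := by
    have hk1 (z : X) : Measurable fun x => k x z := hk.comp measurable_prodMk_right
    have hk2 (x : X) : Measurable fun z => k x z := hk.comp measurable_prodMk_left
    calc ∫⁻ z, g z * q (i + 1) z ∂μ
        = ∫⁻ z, ∫⁻ x, g z * (k x z * q i x) ∂μ ∂μ := by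
          refine lintegral_congr fun z => ?_
          rw [hq_succ, lintegral_const_mul (f := fun x => k x z * q i x) _ ((hk1 z).mul (hq_meas i))]
      _ = ∫⁻ x, ∫⁻ z, g z * (k x z * q i x) ∂μ ∂μ := by
          refine lintegral_lintegral_swap (Measurable.aemeasurable ?_)
          exact (hg.comp measurable_fst).mul
            ((hk.comp measurable_swap).mul ((hq_meas i).comp measurable_snd))
      _ = ∫⁻ x, (∫⁻ z, g z * k x z ∂μ) * q i x ∂μ := by
          refine lintegral_congr fun x => ?_
          rw [← lintegral_mul_const (f := fun z => g z * k x z) _ (hg.mul (hk2 x))]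
          simp_rw [mul_assoc]
      _ ≤ ∫⁻ x, L * q i x ∂μ := lintegral_mono fun x => by gcongr; exact hL x
      _ = L * ∫⁻ x, q i x ∂μ := lintegral_const_mul _ (hq_meas i)
  have hq_mass : ∀ i, ∫⁻ x, q i x ∂μ ≤ 1 := by
    intro i
    induction i with
    | zero => exact hq_one
    | succ i ih =>
      have := hq_step (fun _ => 1) measurable_const 1 (by simpa using hk_one) i
      simp only [one_mul] at this
      exact this.trans ih
  have hq_H : ∀ i, ∫⁻ x, H x * q i x ∂μ ≤ max M M₀ := by
    rintro (_ | i)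
    · exact hqH.trans (le_max_right _ _)
    · calc ∫⁻ x, H x * q (i + 1) x ∂μ ≤ ∫⁻ x, h x * q (i + 1) x ∂μ :=
            lintegral_mono fun x => by gcongr; exact hHh x
        _ ≤ M * ∫⁻ x, q i x ∂μ := hq_step h hh M hkh i
        _ ≤ M * 1 := by gcongr; exact hq_mass i
        _ ≤ max M M₀ := by simp
  have hkiter_step (g : X → ℝ≥0∞) (hg : Measurable g) (L : ℝ≥0∞)
      (hL : ∀ x, ∫⁻ z, g z * k x z ∂μ ≤ L) (r : ℕ) (x : X) :
      ∫⁻ z, g z * kiter (r + 2) x z ∂μ ≤ L * ∫⁻ s, kiter (r + 1) x s ∂μ := by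
    have hk1 (z : X) : Measurable fun x => k x z := hk.comp measurable_prodMk_right
    have hk2 (x : X) : Measurable fun z => k x z := hk.comp measurable_prodMk_left
    have hr : Measurable fun s => kiter (r + 1) x s :=
      (hkiter_meas r).comp measurable_prodMk_left
    calc ∫⁻ z, g z * kiter (r + 2) x z ∂μ
        = ∫⁻ z, ∫⁻ s, g z * (kiter (r + 1) x s * k s z) ∂μ ∂μ := by
          refine lintegral_congr fun z => ?_
          rw [hkiter_succ (r + 2) (by omega), lintegral_const_mul]
          · rfl
          · exact hr.mul (hk1 z)
      _ = ∫⁻ s, ∫⁻ z, g z * (kiter (r + 1) x s * k s z) ∂μ ∂μ := by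
          refine lintegral_lintegral_swap (Measurable.aemeasurable ?_)
          exact (hg.comp measurable_fst).mul
            ((hr.comp measurable_snd).mul (hk.comp measurable_swap))
      _ = ∫⁻ s, (∫⁻ z, g z * k s z ∂μ) * kiter (r + 1) x s ∂μ := by
          refine lintegral_congr fun s => ?_
          rw [← lintegral_mul_const (f := fun z => g z * k s z) _ (hg.mul (hk2 s))]
          refine lintegral_congr fun z => ?_
          ring
      _ ≤ ∫⁻ s, L * kiter (r + 1) x s ∂μ := lintegral_mono fun s => by gcongr; exact hL s
      _ = L * ∫⁻ s, kiter (r + 1) x s ∂μ := lintegral_const_mul _ hr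
  have hkiter_mass : ∀ r x, ∫⁻ z, kiter (r + 1) x z ∂μ ≤ 1 := by
    intro r x
    induction r with
    | zero => simpa [hkiter_one] using hk_one x
    | succ r ih =>
      have := hkiter_step (fun _ => 1) measurable_const 1 (by simpa using hk_one) r x
      simp only [one_mul] at this
      exact this.trans ih
  have hkiter_h : ∀ r x, ∫⁻ z, h z * kiter (r + 1) x z ∂μ ≤ M := by
    rintro (_ | r) x
    · simpa [hkiter_one] using hkh x
    · calc _ ≤ M * ∫⁻ s, kiter (r + 1) x s ∂μ := hkiter_step h hh M hkh r x
        _ ≤ M * 1 := by gcongr; exact hkiter_mass r x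
        _ = M := mul_one M
  obtain ⟨r, hr⟩ : ∃ r, j' - j = r + 1 := ⟨j' - j - 1, by omega⟩
  rw [hr]
  have hr2 (x : X) : Measurable fun z => kiter (r + 1) x z :=
    (hkiter_meas r).comp measurable_prodMk_left
  calc ∫⁻ z, ∫⁻ x, D x z * q j x * kiter (r + 1) x z ∂μ ∂μ
      ≤ ∫⁻ z, ∫⁻ x, C * H x * h z * q j x * kiter (r + 1) x z ∂μ ∂μ :=
        lintegral_mono fun z => lintegral_mono fun x => by gcongr; exact hD x z
    _ = ∫⁻ x, ∫⁻ z, C * H x * h z * q j x * kiter (r + 1) x z ∂μ ∂μ := by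
        refine lintegral_lintegral_swap (Measurable.aemeasurable ?_)
        exact ((((hH.comp measurable_snd).const_mul C).mul (hh.comp measurable_fst)).mul
          ((hq_meas j).comp measurable_snd)).mul ((hkiter_meas r).comp measurable_swap)
    _ = ∫⁻ x, (C * (H x * q j x)) * ∫⁻ z, h z * kiter (r + 1) x z ∂μ ∂μ := by
        refine lintegral_congr fun x => ?_
        rw [← lintegral_const_mul (f := fun z => h z * kiter (r + 1) x z) _ (hh.mul (hr2 x))]
        refine lintegral_congr fun z => ?_
        ring
    _ ≤ ∫⁻ x, (C * (H x * q j x)) * M ∂μ :=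
        lintegral_mono fun x => by gcongr; exact hkiter_h r x
    _ = C * ((∫⁻ x, H x * q j x ∂μ) * M) := by
        rw [lintegral_mul_const (f := fun x => C * (H x * q j x)) _
            ((hH.mul (hq_meas j)).const_mul C),
          lintegral_const_mul (f := fun x => H x * q j x) _ (hH.mul (hq_meas j)), mul_assoc]
    _ ≤ C * (M * max M M₀) := by
        rw [mul_comm _ M]
        gcongr
        exact hq_H j

section PolyaGammaSampler

variable {n p : ℕ} {U : Matrix (Fin n) (Fin p) ℝ} {B : Matrix (Fin p) (Fin p) ℝ}
  {b : Fin p → ℝ} {y : Fin n → ℝ} {gt : ℝ → ℝ}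

theorem dotProduct_pswPrec_mulVec (w : Fin n → ℝ) (x : Fin p → ℝ) :
    x ⬝ᵥ pswPrec U B w *ᵥ x = ∑ i, w i * (U *ᵥ x) i ^ 2 + x ⬝ᵥ B⁻¹ *ᵥ x := by
  rw [pswPrec, add_mulVec, dotProduct_add, ← mulVec_mulVec, ← mulVec_mulVec, dotProduct_mulVec,
    vecMul_transpose]
  congr 1
  simp only [dotProduct, mulVec_diagonal]
  exact Finset.sum_congr rfl fun i _ => by ring

theorem pswPrec_posDef (hB : B.PosDef) {w : Fin n → ℝ} (hw : ∀ i, 0 ≤ w i) :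
    (pswPrec U B w).PosDef := by
  refine PosDef.posSemidef_add ?_ hB.inv
  simpa using (PosSemidef.diagonal (d := w) hw).conjTranspose_mul_mul_same U

theorem le_dotProduct_pswPrec_mulVec {w : Fin n → ℝ} (hw : ∀ i, 0 ≤ w i) (x : Fin p → ℝ) :
    x ⬝ᵥ B⁻¹ *ᵥ x ≤ x ⬝ᵥ pswPrec U B w *ᵥ x := by
  rw [dotProduct_pswPrec_mulVec]
  have := Finset.sum_nonneg fun i (_ : i ∈ Finset.univ) => mul_nonneg (hw i) (sq_nonneg ((U *ᵥ x) i))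
  linarith

theorem dotProduct_pswPrec_inv_mulVec_le (hB : B.PosDef) {w : Fin n → ℝ} (hw : ∀ i, 0 ≤ w i)
    (a : Fin p → ℝ) : a ⬝ᵥ (pswPrec U B w)⁻¹ *ᵥ a ≤ a ⬝ᵥ B *ᵥ a := by
  have h := dotProduct_inv_mulVec_anti (pswPrec_posDef (U := U) hB hw) hB.inv
    (le_dotProduct_pswPrec_mulVec hw) a
  rwa [nonsing_inv_nonsing_inv _ hB.det_pos.ne'.isUnit] at h

theorem dotProduct_pswMu (β : Fin p → ℝ) :
    β ⬝ᵥ pswMu U B b y = ∑ i, (y i - 1/2) * (U *ᵥ β) i + β ⬝ᵥ B⁻¹ *ᵥ b := by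
  rw [pswMu, dotProduct_add, dotProduct_mulVec, vecMul_transpose, dotProduct_comm]
  rfl

theorem exists_det_pswPrec_le (hp : 0 < p) (U : Matrix (Fin n) (Fin p) ℝ)
    (B : Matrix (Fin p) (Fin p) ℝ) :
    ∃ K : ℝ, 0 ≤ K ∧ ∀ w : Fin n → ℝ, (∀ i, 0 ≤ w i) →
      (pswPrec U B w).det ≤ K * (1 + ∑ i, w i ^ p) := by
  obtain ⟨L, hL0, hLU, hLB⟩ : ∃ L : ℝ, 0 ≤ L ∧
      (∀ a a' i, |U i a * U i a'| ≤ L) ∧ ∀ a a', |B⁻¹ a a'| ≤ L := by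
    refine ⟨∑ a, ∑ i, ∑ a', |U i a * U i a'| + ∑ a, ∑ a', |B⁻¹ a a'|, by positivity,
      fun a a' i => ?_, fun a a' => ?_⟩
    · refine le_add_of_le_of_nonneg ?_ (by positivity)
      calc |U i a * U i a'| ≤ ∑ a', |U i a * U i a'| :=
            Finset.single_le_sum (f := fun a' => |U i a * U i a'|)
              (fun _ _ => abs_nonneg _) (Finset.mem_univ a')
        _ ≤ ∑ i, ∑ a', |U i a * U i a'| :=
            Finset.single_le_sum (f := fun i => ∑ a', |U i a * U i a'|)
              (fun _ _ => by positivity) (Finset.mem_univ i)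
        _ ≤ _ := Finset.single_le_sum (f := fun a => ∑ i, ∑ a', |U i a * U i a'|)
              (fun _ _ => by positivity) (Finset.mem_univ a)
    · refine le_add_of_nonneg_of_le (by positivity) ?_
      calc |B⁻¹ a a'| ≤ ∑ a', |B⁻¹ a a'| :=
            Finset.single_le_sum (f := fun a' => |B⁻¹ a a'|)
              (fun _ _ => abs_nonneg _) (Finset.mem_univ a')
        _ ≤ _ := Finset.single_le_sum (f := fun a => ∑ a', |B⁻¹ a a'|)
              (fun _ _ => by positivity) (Finset.mem_univ a)
  refine ⟨p.factorial * L ^ p * ((n + 1) ^ p), by positivity, fun w hw => ?_⟩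
  have hentry (a a' : Fin p) : |pswPrec U B w a a'| ≤ L * (1 + ∑ i, w i) := by
    have e : pswPrec U B w a a' = ∑ i, w i * (U i a * U i a') + B⁻¹ a a' := by
      rw [pswPrec, Matrix.add_apply, Matrix.mul_apply]
      congr 1
      refine Finset.sum_congr rfl fun i _ => ?_
      rw [Matrix.mul_diagonal, Matrix.transpose_apply]
      ring
    calc |pswPrec U B w a a'| ≤ ∑ i, |w i * (U i a * U i a')| + |B⁻¹ a a'| := by
          rw [e]
          exact (abs_add_le _ _).trans (by gcongr; exact Finset.abs_sum_le_sum_abs _ _)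
      _ ≤ ∑ i, w i * L + L := by
          gcongr with i
          · rw [abs_mul, abs_of_nonneg (hw i)]
            exact mul_le_mul_of_nonneg_left (hLU a a' i) (hw i)
          · exact hLB a a'
      _ = L * (1 + ∑ i, w i) := by rw [← Finset.sum_mul]; ring
  have hdet := Matrix.det_le (abv := AbsoluteValue.abs) (A := pswPrec U B w) hentry
  rw [Fintype.card_fin, nsmul_eq_mul, mul_pow] at hdet
  have hpow : (1 + ∑ i, w i) ^ p ≤ (n + 1) ^ p * (1 + ∑ i, w i ^ p) := by
    obtain ⟨p, rfl⟩ : ∃ r, p = r + 1 := ⟨p - 1, by omega⟩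
    have h := pow_sum_le_card_mul_sum_pow (s := Finset.univ)
      (f := fun o : Option (Fin n) => o.elim 1 w)
      (by rintro (_ | i) _ <;> simp [hw]) p
    simp only [Fintype.sum_option, Option.elim, one_pow, Finset.card_univ, Fintype.card_option,
      Fintype.card_fin, Nat.cast_add, Nat.cast_one] at h
    refine h.trans ?_
    have : 0 ≤ 1 + ∑ i, w i ^ (p + 1) := by
      have := Finset.sum_nonneg fun i (_ : i ∈ Finset.univ) => pow_nonneg (hw i) (p + 1)
      linarith
    gcongr
    · linarith [(Nat.cast_nonneg n : (0 : ℝ) ≤ n)]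
    · omega
  calc (pswPrec U B w).det ≤ p.factorial * (L ^ p * (1 + ∑ i, w i) ^ p) :=
        (le_abs_self _).trans hdet
    _ ≤ p.factorial * (L ^ p * ((n + 1) ^ p * (1 + ∑ i, w i ^ p))) := by gcongr
    _ = _ := by ring

theorem lintegral_exp_mul_pswNormalDensity (hB : B.PosDef) {w : Fin n → ℝ} (hw : ∀ i, 0 ≤ w i)
    (a : Fin p → ℝ) :
    ∫⁻ β, ENNReal.ofReal (Real.exp (a ⬝ᵥ β) * pswNormalDensity U B b y β w) =
      ENNReal.ofReal (Real.exp (a ⬝ᵥ (pswPrec U B w)⁻¹ *ᵥ pswMu U B b y +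
        1/2 * (a ⬝ᵥ (pswPrec U B w)⁻¹ *ᵥ a))) :=
  lintegral_exp_dotProduct_mul_gaussian (pswPrec_posDef hB hw) a _

theorem lintegral_pswNormalDensity (hB : B.PosDef) {w : Fin n → ℝ} (hw : ∀ i, 0 ≤ w i) :
    ∫⁻ β, ENNReal.ofReal (pswNormalDensity U B b y β w) = 1 := by
  simpa using lintegral_exp_mul_pswNormalDensity (U := U) (b := b) (y := y) hB hw 0

theorem lintegral_exp_mul_pswNormalDensity_le (hB : B.PosDef) {w : Fin n → ℝ}
    (hw : ∀ i, 0 ≤ w i) (a : Fin p → ℝ) :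
    ∫⁻ β, ENNReal.ofReal (Real.exp (a ⬝ᵥ β) * pswNormalDensity U B b y β w) ≤
      ENNReal.ofReal (Real.exp (a ⬝ᵥ B *ᵥ a +
        1/2 * (pswMu U B b y ⬝ᵥ B *ᵥ pswMu U B b y))) := by
  rw [lintegral_exp_mul_pswNormalDensity hB hw]
  gcongr ENNReal.ofReal (Real.exp ?_)
  have h1 := two_mul_dotProduct_inv_mulVec_le (pswPrec_posDef (U := U) hB hw) a (pswMu U B b y)
  have h2 := dotProduct_pswPrec_inv_mulVec_le (U := U) hB hw a
  have h3 := dotProduct_pswPrec_inv_mulVec_le (U := U) hB hw (pswMu U B b y)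
  linarith

theorem pswNormalDensity_nonneg (hB : B.PosDef) {w : Fin n → ℝ} (hw : ∀ i, 0 ≤ w i)
    (β : Fin p → ℝ) : 0 ≤ pswNormalDensity U B b y β w := by
  have := (pswPrec_posDef (U := U) hB hw).det_pos
  unfold pswNormalDensity
  positivity

theorem logisticF_rpow_mul {t r : ℝ} (hr : r = 0 ∨ r = 1) :
    logisticF t ^ r * (1 - logisticF t) ^ (1 - r) =
      Real.exp ((r - 1/2) * t) / (2 * Real.cosh (t / 2)) := by
  have h1 : 1 + Real.exp t = Real.exp (1/2 * t) * (2 * Real.cosh (t / 2)) := by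
    rw [Real.cosh_eq, mul_div_cancel₀ _ two_ne_zero, mul_add, ← Real.exp_add, ← Real.exp_add,
      add_comm]
    congr 1
    · ring_nf
    · ring_nf; simp
  have h2 : 1 - logisticF t = 1 / (1 + Real.exp t) := by
    unfold logisticF
    field_simp
    ring
  have hc := Real.cosh_pos (t / 2)
  rcases hr with rfl | rfl
  · rw [h2, h1, Real.rpow_zero, sub_zero, Real.rpow_one, zero_sub, neg_mul, Real.exp_neg]
    field_simp
  · rw [logisticF, h1, sub_self, Real.rpow_zero, Real.rpow_one, mul_one,
      show t = 1/2 * t + 1/2 * t by ring, Real.exp_add]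
    ring_nf
    field_simp

theorem pswLik_eq (hy : ∀ i, y i = 0 ∨ y i = 1) (β : Fin p → ℝ) :
    pswLik U y β * (2 ^ n * ∏ i, Real.cosh ((U *ᵥ β) i / 2)) =
      Real.exp (∑ i, (y i - 1/2) * (U *ᵥ β) i) := by
  have h2 : (2 : ℝ) ^ n = ∏ _i : Fin n, (2 : ℝ) := by simp
  rw [h2, ← Finset.prod_mul_distrib, pswLik, ← Finset.prod_mul_distrib, Real.exp_sum]
  refine Finset.prod_congr rfl fun i _ => ?_
  rw [logisticF_rpow_mul (hy i), div_mul_cancel₀]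
  have := Real.cosh_pos ((U *ᵥ β) i / 2)
  positivity

theorem pswPrior_pos (hB : B.PosDef) (β : Fin p → ℝ) : 0 < pswPrior B b β := by
  have := hB.det_pos
  unfold pswPrior
  positivity

theorem pswLik_pos (β : Fin p → ℝ) : 0 < pswLik U y β := by
  refine Finset.prod_pos fun i _ => mul_pos (Real.rpow_pos_of_pos ?_ _) (Real.rpow_pos_of_pos ?_ _)
  · unfold logisticF; positivity
  · unfold logisticF
    rw [sub_pos, div_lt_one (by positivity)]
    linarith

theorem pswNormalDensity_le (hB : B.PosDef) (hy : ∀ i, y i = 0 ∨ y i = 1) {w : Fin n → ℝ}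
    (hw : ∀ i, 0 ≤ w i) (β : Fin p → ℝ) :
    pswNormalDensity U B b y β w ≤
      (2 ^ n * B.det ^ ((1 : ℝ) / 2) * Real.exp (1/2 * (b ⬝ᵥ B⁻¹ *ᵥ b))) *
        (pswPrec U B w).det ^ ((1 : ℝ) / 2) * (∏ i, Real.cosh ((U *ᵥ β) i / 2)) *
        (pswPrior B b β * pswLik U y β) := by
  have hP := pswPrec_posDef (U := U) hB hw
  have hdet := hP.det_pos
  have hBdet := hB.det_pos
  set m := pswMu U B b y with hm
  have hPs : pswPrec U B w *ᵥ ((pswPrec U B w)⁻¹ *ᵥ m) = m := by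
    rw [mulVec_mulVec, mul_nonsing_inv _ hdet.ne'.isUnit, one_mulVec]
  have hexp : -(1/2) * ((β - (pswPrec U B w)⁻¹ *ᵥ m) ⬝ᵥ
      (pswPrec U B w) *ᵥ (β - (pswPrec U B w)⁻¹ *ᵥ m)) ≤
      1/2 * (b ⬝ᵥ B⁻¹ *ᵥ b) + -(1/2) * ((β - b) ⬝ᵥ B⁻¹ *ᵥ (β - b)) +
        ∑ i, (y i - 1/2) * (U *ᵥ β) i := by
    have h1 := dotProduct_mulVec_comm_of_isHermitian hP.1 ((pswPrec U B w)⁻¹ *ᵥ m) β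
    have h2 := dotProduct_mulVec_comm_of_isHermitian hB.inv.1 b β
    have h3 := le_dotProduct_pswPrec_mulVec (U := U) (B := B) hw β
    have h4 := hP.inv.posSemidef.dotProduct_mulVec_nonneg m
    have h5 := dotProduct_pswMu (U := U) (B := B) (b := b) (y := y) β
    rw [star_trivial] at h4
    rw [← hm] at h5
    rw [mulVec_sub, mulVec_sub, sub_dotProduct, dotProduct_sub, dotProduct_sub, h1, hPs,
      dotProduct_comm ((pswPrec U B w)⁻¹ *ᵥ m) m, sub_dotProduct, dotProduct_sub, dotProduct_sub, h2]
    linarith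
  calc pswNormalDensity U B b y β w
      ≤ (2 * Real.pi) ^ (-(p : ℝ) / 2) * (pswPrec U B w).det ^ ((1 : ℝ) / 2) *
        (Real.exp (1/2 * (b ⬝ᵥ B⁻¹ *ᵥ b)) * Real.exp (-(1/2) * ((β - b) ⬝ᵥ B⁻¹ *ᵥ (β - b))) *
          Real.exp (∑ i, (y i - 1/2) * (U *ᵥ β) i)) := by
        rw [← Real.exp_add, ← Real.exp_add]
        unfold pswNormalDensity
        gcongr
    _ = (B.det ^ ((1 : ℝ) / 2) * B.det ^ (-(1 : ℝ) / 2)) *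
        ((2 * Real.pi) ^ (-(p : ℝ) / 2) * (pswPrec U B w).det ^ ((1 : ℝ) / 2) *
        (Real.exp (1/2 * (b ⬝ᵥ B⁻¹ *ᵥ b)) * Real.exp (-(1/2) * ((β - b) ⬝ᵥ B⁻¹ *ᵥ (β - b))) *
          Real.exp (∑ i, (y i - 1/2) * (U *ᵥ β) i))) := by
        rw [← Real.rpow_add hBdet]; norm_num
    _ = _ := by
        rw [← pswLik_eq hy β, pswPrior]
        ring

theorem sq_pswNormalDensity_div_le (hB : B.PosDef) (hy : ∀ i, y i = 0 ∨ y i = 1)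
    {w : Fin n → ℝ} (hw : ∀ i, 0 ≤ w i) {c : ℝ} (hc : 0 < c) (β : Fin p → ℝ) :
    (pswNormalDensity U B b y β w / (pswPrior B b β * pswLik U y β / c)) ^ 2 ≤
      (c * (2 ^ n * B.det ^ ((1 : ℝ) / 2) * Real.exp (1/2 * (b ⬝ᵥ B⁻¹ *ᵥ b)))) ^ 2 *
        (∏ i, Real.cosh ((U *ᵥ β) i / 2) ^ 2) * (pswPrec U B w).det := by
  have hdet := (pswPrec_posDef (U := U) hB hw).det_pos
  have hpos := mul_pos (pswPrior_pos (b := b) hB β) (pswLik_pos (U := U) (y := y) β)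
  have h0 := pswNormalDensity_nonneg (U := U) (b := b) (y := y) hB hw β
  set K := 2 ^ n * B.det ^ ((1 : ℝ) / 2) * Real.exp (1/2 * (b ⬝ᵥ B⁻¹ *ᵥ b)) with hK
  have h1 : pswNormalDensity U B b y β w / (pswPrior B b β * pswLik U y β / c) ≤
      c * K * (pswPrec U B w).det ^ ((1 : ℝ) / 2) * ∏ i, Real.cosh ((U *ᵥ β) i / 2) := by
    rw [div_le_iff₀ (by positivity)]
    refine (pswNormalDensity_le hB hy hw β).trans (le_of_eq ?_)
    rw [← hK]
    field_simp
  have h2 : ((pswPrec U B w).det ^ ((1 : ℝ) / 2)) ^ 2 = (pswPrec U B w).det := by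
    rw [← Real.rpow_natCast, ← Real.rpow_mul hdet.le]; norm_num
  calc _ ≤ (c * K * (pswPrec U B w).det ^ ((1 : ℝ) / 2) *
        ∏ i, Real.cosh ((U *ᵥ β) i / 2)) ^ 2 := by
        gcongr
    _ = _ := by rw [mul_pow, mul_pow, h2, Finset.prod_pow]; ring

theorem ae_pswWMeasure_pos : ∀ᵐ w ∂(pswWMeasure n), ∀ i, 0 < w i :=
  ae_all_iff.2 fun i =>
    (Measure.tendsto_eval_ae_ae (μ := fun _ : Fin n => volume.restrict (Set.Ioi (0 : ℝ)))
      (i := i)).eventually (ae_restrict_mem measurableSet_Ioi)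

instance : SigmaFinite (pswWMeasure n) := by
  unfold pswWMeasure
  infer_instance

section Measurability

variable {X : Type*} [MeasurableSpace X]

theorem continuous_pswPrec : Continuous fun w : Fin n → ℝ => pswPrec U B w := by
  unfold pswPrec
  fun_prop

theorem measurable_pswPrec_inv_apply (a a' : Fin p) :
    Measurable fun w : Fin n → ℝ => (pswPrec U B w)⁻¹ a a' := by
  simp only [Matrix.inv_def, Ring.inverse_eq_inv', Matrix.smul_apply, smul_eq_mul]
  exact (continuous_pswPrec.matrix_det.measurable.inv).mul
    (continuous_pswPrec.matrix_adjugate.matrix_elem a a').measurable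

theorem measurable_mulVec_apply {m l : ℕ} {P : X → Matrix (Fin m) (Fin l) ℝ} {v : X → Fin l → ℝ}
    (hP : ∀ i j, Measurable fun x => P x i j) (hv : ∀ j, Measurable fun x => v x j) (i : Fin m) :
    Measurable fun x => (P x *ᵥ v x) i := by
  simp only [mulVec, dotProduct]
  fun_prop

theorem Measurable.pswNormalDensity {f : X → Fin p → ℝ} {g : X → Fin n → ℝ} (hf : Measurable f)
    (hg : Measurable g) : Measurable fun x => pswNormalDensity U B b y (f x) (g x) := by
  have hP (i j : Fin p) : Measurable fun x => pswPrec U B (g x) i j :=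
    (continuous_pswPrec.matrix_elem i j).measurable.comp hg
  have hdet : Measurable fun x => (pswPrec U B (g x)).det :=
    continuous_pswPrec.matrix_det.measurable.comp hg
  have hv (i : Fin p) :
      Measurable fun x => (f x - (pswPrec U B (g x))⁻¹ *ᵥ pswMu U B b y) i :=
    ((measurable_pi_apply i).comp hf).sub (measurable_mulVec_apply
      (P := fun x => (pswPrec U B (g x))⁻¹) (v := fun _ => pswMu U B b y) (fun i j => (measurable_pswPrec_inv_apply i j).comp hg) (fun _ => measurable_const) i)
  refine Measurable.mul ((hdet.pow_const _).const_mul _) (Measurable.exp (Measurable.const_mul ?_ _))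
  exact Finset.measurable_sum _ fun i _ => (hv i).mul (measurable_mulVec_apply hP hv i)

theorem Measurable.pswPGDensity (hgt : Measurable gt) {f : X → Fin p → ℝ} {g : X → Fin n → ℝ}
    (hf : Measurable f) (hg : Measurable g) : Measurable fun x => pswPGDensity U gt (g x) (f x) := by
  have hU (i : Fin n) : Measurable fun x => (U *ᵥ f x) i :=
    measurable_mulVec_apply (P := fun _ => U) (fun _ _ => measurable_const)
      (fun j => (measurable_pi_apply j).comp hf) i
  have hgi (i : Fin n) : Measurable fun x => g x i := (measurable_pi_apply i).comp hg
  refine Finset.measurable_prod _ fun i _ => Measurable.mul (Measurable.mul ?_ ?_) ?_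
  · exact Real.continuous_cosh.measurable.comp ((hU i).div_const _)
  · exact Measurable.exp ((((hU i).pow_const 2).const_mul _).mul (hgi i))
  · exact hgt.comp (hgi i)

theorem measurable_lintegral_psw_transition (hgt : Measurable gt) :
    Measurable fun a : (Fin p → ℝ) × (Fin p → ℝ) => ∫⁻ w,
      ENNReal.ofReal (pswNormalDensity U B b y a.2 w * pswPGDensity U gt w a.1)
        ∂(pswWMeasure n) := by
  refine Measurable.lintegral_prod_right' (f := fun a : ((Fin p → ℝ) × (Fin p → ℝ)) ×
    (Fin n → ℝ) => ENNReal.ofReal (pswNormalDensity U B b y a.1.2 a.2 *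
      pswPGDensity U gt a.2 a.1.1)) (Measurable.ennreal_ofReal (Measurable.mul ?_ ?_))
  · exact Measurable.pswNormalDensity measurable_fst.snd measurable_snd
  · exact Measurable.pswPGDensity hgt measurable_fst.fst measurable_snd

end Measurability

theorem pswPGDensity_nonneg (hgt_nonneg : ∀ w, 0 < w → 0 ≤ gt w) {w : Fin n → ℝ}
    (hw : ∀ i, 0 < w i) (β : Fin p → ℝ) : 0 ≤ pswPGDensity U gt w β :=
  Finset.prod_nonneg fun i _ =>
    mul_nonneg (mul_nonneg (Real.cosh_pos _).le (Real.exp_pos _).le) (hgt_nonneg _ (hw i))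

theorem pswPGDensity_le (hgt_nonneg : ∀ w, 0 < w → 0 ≤ gt w) {w : Fin n → ℝ}
    (hw : ∀ i, 0 < w i) (β : Fin p → ℝ) :
    pswPGDensity U gt w β ≤ (∏ i, Real.cosh ((U *ᵥ β) i / 2)) * ∏ i, gt (w i) := by
  rw [← Finset.prod_mul_distrib]
  have hg (i : Fin n) := hgt_nonneg _ (hw i)
  refine Finset.prod_le_prod (fun i _ => mul_nonneg (mul_nonneg (Real.cosh_pos _).le
    (Real.exp_pos _).le) (hg i)) fun i _ => ?_
  have hc := (Real.cosh_pos ((U *ᵥ β) i / 2)).le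
  have he : Real.exp (-(1/2) * ((U *ᵥ β) i) ^ 2 * w i) ≤ 1 := by
    rw [Real.exp_le_one_iff]
    have := mul_nonneg (sq_nonneg ((U *ᵥ β) i)) (hw i).le
    linarith
  exact mul_le_mul_of_nonneg_right (mul_le_of_le_one_right hc he) (hg i)

theorem lintegral_pswPGDensity (hgt_nonneg : ∀ w, 0 < w → 0 ≤ gt w)
    (hgt_laplace : ∀ c : ℝ,
      ∫ w in Set.Ioi (0 : ℝ), Real.exp (-(c ^ 2) * w / 2) * gt w = 1 / Real.cosh (c / 2))
    (β : Fin p → ℝ) :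
    ∫⁻ w, ENNReal.ofReal (pswPGDensity U gt w β) ∂(pswWMeasure n) = 1 := by
  have hcosh (t : ℝ) := Real.cosh_pos (t / 2)
  have hint (t : ℝ) : IntegrableOn (fun w => Real.exp (-(t ^ 2) * w / 2) * gt w) (Set.Ioi 0) := by
    refine not_imp_comm.1 integral_undef ?_
    rw [hgt_laplace]
    exact (one_div_pos.2 (hcosh t)).ne'
  have e (t w : ℝ) : Real.cosh (t / 2) * Real.exp (-(1/2) * t ^ 2 * w) * gt w =
      Real.cosh (t / 2) * (Real.exp (-(t ^ 2) * w / 2) * gt w) := by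
    rw [mul_assoc]; ring_nf
  have h := lintegral_ofReal_fintype_prod (μ := volume.restrict (Set.Ioi (0 : ℝ)))
    (f := fun (i : Fin n) w =>
      Real.cosh ((U *ᵥ β) i / 2) * Real.exp (-(1/2) * ((U *ᵥ β) i) ^ 2 * w) * gt w)
    (fun i => by
      simp_rw [e]
      exact (hint _).const_mul _)
    (fun i => by
      filter_upwards [ae_restrict_mem measurableSet_Ioi] with w hw
      exact mul_nonneg (mul_nonneg (hcosh _).le (Real.exp_pos _).le) (hgt_nonneg _ hw))
  refine h.trans ?_
  simp_rw [e, integral_const_mul, hgt_laplace]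
  rw [Finset.prod_eq_one, ENNReal.ofReal_one]
  intro i _
  exact mul_one_div_cancel (hcosh _).ne'

theorem exists_lintegral_det_mul_pswPGDensity_le (hp : 0 < p) (U : Matrix (Fin n) (Fin p) ℝ)
    (B : Matrix (Fin p) (Fin p) ℝ)
    (hgt_meas : Measurable gt) (hgt_nonneg : ∀ w, 0 < w → 0 ≤ gt w)
    (hgt_mom : ∫⁻ w in Set.Ioi (0 : ℝ), ENNReal.ofReal (w ^ p * gt w) < ⊤)
    (hgt_int : IntegrableOn gt (Set.Ioi 0)) :
    ∃ C : ℝ≥0∞, C ≠ ⊤ ∧ ∀ β : Fin p → ℝ,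
      ∫⁻ w, ENNReal.ofReal ((pswPrec U B w).det * pswPGDensity U gt w β) ∂(pswWMeasure n) ≤
        C * ENNReal.ofReal (∏ i, Real.cosh ((U *ᵥ β) i / 2)) := by
  have hnn : 0 ≤ᵐ[volume.restrict (Set.Ioi (0 : ℝ))] gt := by
    filter_upwards [ae_restrict_mem measurableSet_Ioi] with w hw using hgt_nonneg w hw
  have hmom : IntegrableOn (fun w => w ^ p * gt w) (Set.Ioi 0) := by
    refine ⟨by fun_prop, ?_⟩
    rwa [hasFiniteIntegral_iff_ofReal]
    filter_upwards [ae_restrict_mem measurableSet_Ioi] with w hw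
    exact mul_nonneg (pow_nonneg (le_of_lt hw) p) (hgt_nonneg w hw)
  obtain ⟨K, hK0, hK⟩ := exists_det_pswPrec_le hp U B
  have hfin_one : ∫⁻ w, ENNReal.ofReal (∏ i, gt (w i)) ∂(pswWMeasure n) ≠ ⊤ :=
    (lintegral_ofReal_fintype_prod (f := fun _ : Fin n => gt) (fun _ => hgt_int)
      fun _ => hnn).trans_ne ENNReal.ofReal_ne_top
  have hfin_pow (i : Fin n) :
      ∫⁻ w, ENNReal.ofReal (w i ^ p * ∏ j, gt (w j)) ∂(pswWMeasure n) ≠ ⊤ := by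
    have h := lintegral_ofReal_fintype_prod (μ := volume.restrict (Set.Ioi (0 : ℝ)))
      (f := fun (j : Fin n) x => (if j = i then x ^ p else 1) * gt x)
      (fun j => by
        by_cases hj : j = i
        · simp only [hj, if_true]
          exact hmom
        · simp only [hj, if_false, one_mul]
          exact hgt_int)
      (fun j => by
        filter_upwards [ae_restrict_mem measurableSet_Ioi] with x hx
        refine mul_nonneg ?_ (hgt_nonneg _ hx)
        split_ifs
        exacts [pow_nonneg (le_of_lt hx) p, zero_le_one])
    simp only [Finset.prod_mul_distrib, Finset.prod_ite_eq', Finset.mem_univ, if_true] at h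
    exact h.trans_ne ENNReal.ofReal_ne_top
  refine ⟨ENNReal.ofReal K * (∫⁻ w, ENNReal.ofReal (∏ i, gt (w i)) ∂(pswWMeasure n) +
    ∑ i, ∫⁻ w, ENNReal.ofReal (w i ^ p * ∏ j, gt (w j)) ∂(pswWMeasure n)),
    ENNReal.mul_ne_top ENNReal.ofReal_ne_top (ENNReal.add_ne_top.2 ⟨hfin_one,
      ENNReal.sum_ne_top.2 fun i _ => hfin_pow i⟩), fun β => ?_⟩
  have hH : 0 ≤ ∏ i, Real.cosh ((U *ᵥ β) i / 2) :=
    Finset.prod_nonneg fun i _ => (Real.cosh_pos _).le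
  rw [← lintegral_finsetSum' _ (fun i _ => by fun_prop), ← lintegral_add_left (by fun_prop),
    ← lintegral_const_mul _ (by fun_prop), ← lintegral_mul_const _ (by fun_prop)]
  refine lintegral_mono_ae ?_
  filter_upwards [ae_pswWMeasure_pos] with w hw
  have hg : 0 ≤ ∏ i, gt (w i) := Finset.prod_nonneg fun i _ => hgt_nonneg _ (hw i)
  have hwp (i : Fin n) : 0 ≤ w i ^ p := pow_nonneg (hw i).le p
  rw [← ENNReal.ofReal_sum_of_nonneg fun i _ => mul_nonneg (hwp i) hg, ← ENNReal.ofReal_add hg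
    (Finset.sum_nonneg fun i _ => mul_nonneg (hwp i) hg), ← ENNReal.ofReal_mul hK0,
    ← ENNReal.ofReal_mul' hH]
  refine ENNReal.ofReal_le_ofReal ?_
  have hs : 0 ≤ 1 + ∑ i, w i ^ p :=
    add_nonneg zero_le_one (Finset.sum_nonneg fun i _ => hwp i)
  calc (pswPrec U B w).det * pswPGDensity U gt w β
      ≤ (K * (1 + ∑ i, w i ^ p)) * ((∏ i, Real.cosh ((U *ᵥ β) i / 2)) * ∏ i, gt (w i)) :=
        mul_le_mul (hK w fun i => (hw i).le) (pswPGDensity_le hgt_nonneg hw β)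
          (pswPGDensity_nonneg hgt_nonneg hw β) (mul_nonneg hK0 hs)
    _ = _ := by rw [← Finset.sum_mul]; ring

/-- A Fubini bound for transitions through the latent variable: a uniform bound on the `g`-integral
of the Gaussian conditional is inherited by the mixture over the Polya-Gamma conditional. -/
theorem lintegral_mul_psw_transition_le (hgt_meas : Measurable gt)
    (hgt_nonneg : ∀ w, 0 < w → 0 ≤ gt w)
    (hgt_laplace : ∀ c : ℝ,
      ∫ w in Set.Ioi (0 : ℝ), Real.exp (-(c ^ 2) * w / 2) * gt w = 1 / Real.cosh (c / 2))
    {g : (Fin p → ℝ) → ℝ≥0∞} (hg : Measurable g) {M : ℝ≥0∞}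
    (hM : ∀ w : Fin n → ℝ, (∀ i, 0 ≤ w i) →
      ∫⁻ β, g β * ENNReal.ofReal (pswNormalDensity U B b y β w) ≤ M) (βt : Fin p → ℝ) :
    ∫⁻ β, g β * ∫⁻ w, ENNReal.ofReal (pswNormalDensity U B b y β w * pswPGDensity U gt w βt)
      ∂(pswWMeasure n) ≤ M := by
  have hG : Measurable fun w => pswPGDensity U gt w βt :=
    Measurable.pswPGDensity hgt_meas measurable_const measurable_id
  have hN (β : Fin p → ℝ) : Measurable fun w => pswNormalDensity U B b y β w :=
    Measurable.pswNormalDensity measurable_const measurable_id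
  calc ∫⁻ β, g β * ∫⁻ w, ENNReal.ofReal (pswNormalDensity U B b y β w *
        pswPGDensity U gt w βt) ∂(pswWMeasure n)
      = ∫⁻ β, ∫⁻ w, g β * ENNReal.ofReal (pswNormalDensity U B b y β w *
        pswPGDensity U gt w βt) ∂(pswWMeasure n) :=
        lintegral_congr fun β =>
          (lintegral_const_mul _ ((hN β).mul hG).ennreal_ofReal).symm
    _ = ∫⁻ w, ∫⁻ β, g β * ENNReal.ofReal (pswNormalDensity U B b y β w *
        pswPGDensity U gt w βt) ∂volume ∂(pswWMeasure n) := by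
        refine lintegral_lintegral_swap (Measurable.aemeasurable ?_)
        exact (hg.comp measurable_fst).mul ((Measurable.pswNormalDensity measurable_fst
          measurable_snd).mul (hG.comp measurable_snd)).ennreal_ofReal
    _ ≤ ∫⁻ w, M * ENNReal.ofReal (pswPGDensity U gt w βt) ∂(pswWMeasure n) := by
        refine lintegral_mono_ae ?_
        filter_upwards [ae_pswWMeasure_pos] with w hw
        have hG0 := pswPGDensity_nonneg (U := U) hgt_nonneg hw βt
        simp_rw [ENNReal.ofReal_mul' hG0, ← mul_assoc]
        rw [lintegral_mul_const' _ _ ENNReal.ofReal_ne_top]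
        gcongr
        exact hM w fun i => (hw i).le
    _ = M := by
        rw [lintegral_const_mul _ hG.ennreal_ofReal,
          lintegral_pswPGDensity hgt_nonneg hgt_laplace, mul_one]

theorem prod_cosh_sq_le (t : Fin n → ℝ) :
    ∏ i, Real.cosh (t i / 2) ^ 2 ≤
      ∑ s : Fin n → Bool, Real.exp (∑ i, (if s i then 1 else -1) * t i) := by
  have h1 (r : ℝ) : Real.cosh (r / 2) ^ 2 ≤ ∑ s : Bool, Real.exp ((if s then 1 else -1) * r) := by
    have h2 : Real.cosh (r / 2) ^ 2 = (Real.cosh r + 1) / 2 := by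
      have := Real.cosh_two_mul (r / 2)
      have h3 := Real.cosh_sq (r / 2)
      rw [mul_div_cancel₀ _ two_ne_zero] at this
      linarith
    have h4 := Real.one_le_cosh r
    have h5 := Real.cosh_eq r
    simp only [Fintype.sum_bool, if_true, Bool.false_eq_true, if_false, one_mul, neg_one_mul]
    linarith
  simp_rw [Real.exp_sum]
  rw [← Fintype.prod_sum (fun i (s : Bool) => Real.exp ((if s then 1 else -1) * t i))]
  exact Finset.prod_le_prod (fun i _ => sq_nonneg _) fun i _ => h1 (t i)

theorem exists_lintegral_cosh_sq_mul_pswNormalDensity_le (hB : B.PosDef)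
    (U : Matrix (Fin n) (Fin p) ℝ) (b : Fin p → ℝ) (y : Fin n → ℝ) :
    ∃ M : ℝ≥0∞, M ≠ ⊤ ∧ ∀ w : Fin n → ℝ, (∀ i, 0 ≤ w i) →
      ∫⁻ β, ENNReal.ofReal (∏ i, Real.cosh ((U *ᵥ β) i / 2) ^ 2) *
        ENNReal.ofReal (pswNormalDensity U B b y β w) ≤ M := by
  let a (s : Fin n → Bool) : Fin p → ℝ := Uᵀ *ᵥ fun i => if s i then 1 else -1
  have ha (s : Fin n → Bool) (β : Fin p → ℝ) :
      ∑ i, (if s i then 1 else -1) * (U *ᵥ β) i = a s ⬝ᵥ β := by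
    change _ = (Uᵀ *ᵥ fun i => if s i then (1 : ℝ) else -1) ⬝ᵥ β
    rw [mulVec_transpose, ← dotProduct_mulVec]
    rfl
  refine ⟨∑ s : Fin n → Bool, ENNReal.ofReal (Real.exp (a s ⬝ᵥ B *ᵥ a s +
        1/2 * (pswMu U B b y ⬝ᵥ B *ᵥ pswMu U B b y))),
    ENNReal.sum_ne_top.2 fun _ _ => ENNReal.ofReal_ne_top, fun w hw => ?_⟩
  have hN : Measurable fun β => pswNormalDensity U B b y β w :=
    Measurable.pswNormalDensity measurable_id measurable_const
  calc _ ≤ ∫⁻ β, ∑ s : Fin n → Bool,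
          ENNReal.ofReal (Real.exp (a s ⬝ᵥ β) * pswNormalDensity U B b y β w) := by
        refine lintegral_mono fun β => ?_
        have hN0 := pswNormalDensity_nonneg (U := U) (b := b) (y := y) hB hw β
        rw [← ENNReal.ofReal_mul' hN0, ← ENNReal.ofReal_sum_of_nonneg
          fun s _ => mul_nonneg (Real.exp_pos _).le hN0, ← Finset.sum_mul]
        gcongr
        refine (prod_cosh_sq_le (U *ᵥ β)).trans_eq ?_
        simp_rw [ha]
    _ = ∑ s : Fin n → Bool, ∫⁻ β,
          ENNReal.ofReal (Real.exp (a s ⬝ᵥ β) * pswNormalDensity U B b y β w) := by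
        refine lintegral_finsetSum' _ fun s _ => Measurable.aemeasurable ?_
        refine (Measurable.mul ?_ hN).ennreal_ofReal
        simp only [dotProduct]
        fun_prop
    _ ≤ _ := Finset.sum_le_sum fun s _ => lintegral_exp_mul_pswNormalDensity_le hB hw (a s)

theorem lintegral_prod_cosh_mul_lt_top {q₀ : (Fin p → ℝ) → ℝ} (hq₀_nonneg : ∀ β, 0 ≤ q₀ β)
    (hq₀_exp : ∫⁻ β : Fin p → ℝ,
      ENNReal.ofReal (Real.exp ((1/2) * ∑ i, |(U *ᵥ β) i|) * q₀ β) ∂volume < ⊤) :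
    ∫⁻ β, ENNReal.ofReal (∏ i, Real.cosh ((U *ᵥ β) i / 2)) * ENNReal.ofReal (q₀ β) < ⊤ := by
  refine lt_of_le_of_lt (lintegral_mono fun β => ?_) hq₀_exp
  rw [← ENNReal.ofReal_mul' (hq₀_nonneg β), Finset.mul_sum, Real.exp_sum]
  gcongr with i
  · exact hq₀_nonneg β
  · rw [← Real.cosh_abs, abs_div, abs_two, Real.cosh_eq]
    have : Real.exp (-(|(U *ᵥ β) i| / 2)) ≤ Real.exp (|(U *ᵥ β) i| / 2) := by
      gcongr
      linarith [abs_nonneg ((U *ᵥ β) i)]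
    rw [show (1 / 2 : ℝ) * |(U *ᵥ β) i| = |(U *ᵥ β) i| / 2 by ring]
    linarith

end PolyaGammaSampler


/-- Theorem 5: the variance condition (B) holds for the PS&W chain, uniformly over all time
pairs `j < j'`, whenever the initial density `q₀` integrates `exp((1/2)∑ᵢ|uᵢᵀβ|)`. Here `k` is
the PS&W Markov transition density, `kiter r` its `r`-step iterate, `q j` the density of the
chain at time `j`, and `q j β̃ · kiter (j'−j) β̃ β` is the joint density at times `j` and `j'`. -/
theorem stmt_14 {n p : ℕ} (hn : 0 < n) (hp : 0 < p)
    (U : Matrix (Fin n) (Fin p) ℝ) (B : Matrix (Fin p) (Fin p) ℝ) (hB : B.PosDef)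
    (b : Fin p → ℝ) (y : Fin n → ℝ) (hy : ∀ i, y i = 0 ∨ y i = 1)
    (gt : ℝ → ℝ) (hgt_meas : Measurable gt) (hgt_nonneg : ∀ w, 0 < w → 0 ≤ gt w)
    (hgt_mom : ∫⁻ w in Set.Ioi (0 : ℝ), ENNReal.ofReal (w ^ p * gt w) < ⊤)
    (hgt_laplace : ∀ c : ℝ,
      ∫ w in Set.Ioi (0 : ℝ), Real.exp (-(c ^ 2) * w / 2) * gt w = 1 / Real.cosh (c / 2))
    (c : ℝ)
    (hc_int : Integrable (fun β : Fin p → ℝ => pswPrior B b β * pswLik U y β)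
      (volume : Measure (Fin p → ℝ)))
    (hc_def : c = ∫ β : Fin p → ℝ, pswPrior B b β * pswLik U y β ∂volume)
    (hc_pos : 0 < c)
    (k : (Fin p → ℝ) → (Fin p → ℝ) → ℝ≥0∞)
    (hk : ∀ βt β, k βt β = ∫⁻ w,
      ENNReal.ofReal (pswNormalDensity U B b y β w * pswPGDensity U gt w βt) ∂(pswWMeasure n))
    (kiter : ℕ → (Fin p → ℝ) → (Fin p → ℝ) → ℝ≥0∞)
    (hkiter_one : kiter 1 = k)
    (hkiter_succ : ∀ r : ℕ, 2 ≤ r → ∀ βt β,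
      kiter r βt β = ∫⁻ βs : Fin p → ℝ, kiter (r - 1) βt βs * k βs β ∂volume)
    (q₀ : (Fin p → ℝ) → ℝ) (hq₀_meas : Measurable q₀) (hq₀_nonneg : ∀ β, 0 ≤ q₀ β)
    (hq₀_prob : ∫⁻ β : Fin p → ℝ, ENNReal.ofReal (q₀ β) ∂volume = 1)
    (hq₀_exp : ∫⁻ β : Fin p → ℝ,
      ENNReal.ofReal (Real.exp ((1/2) * ∑ i, |(U *ᵥ β) i|) * q₀ β) ∂volume < ⊤)
    (q : ℕ → (Fin p → ℝ) → ℝ≥0∞)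
    (hq_zero : ∀ β, q 0 β = ENNReal.ofReal (q₀ β))
    (hq_succ : ∀ j β, q (j + 1) β = ∫⁻ βt : Fin p → ℝ, k βt β * q j βt ∂volume) :
    ∃ Cs : ℝ, ∀ j j' : ℕ, j < j' →
      ∫⁻ β : Fin p → ℝ, ∫⁻ βt : Fin p → ℝ,
          (∫⁻ w, ENNReal.ofReal
              ((pswNormalDensity U B b y β w / (pswPrior B b β * pswLik U y β / c)) ^ 2 *
                pswPGDensity U gt w βt) ∂(pswWMeasure n))
            * q j βt * kiter (j' - j) βt β ∂volume ∂volume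
        ≤ ENNReal.ofReal Cs := by
  have hgt_int : IntegrableOn gt (Set.Ioi 0) := by
    refine not_imp_comm.1 integral_undef ?_
    have := hgt_laplace 0
    simp at this
    simp [this]
  obtain ⟨C, hC, hCle⟩ := exists_lintegral_det_mul_pswPGDensity_le hp U B hgt_meas hgt_nonneg
    hgt_mom hgt_int
  obtain ⟨M, hM, hMle⟩ := exists_lintegral_cosh_sq_mul_pswNormalDensity_le hB U b y
  set H : (Fin p → ℝ) → ℝ≥0∞ :=
    fun β => ENNReal.ofReal (∏ i, Real.cosh ((U *ᵥ β) i / 2)) with hH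
  set h : (Fin p → ℝ) → ℝ≥0∞ :=
    fun β => ENNReal.ofReal (∏ i, Real.cosh ((U *ᵥ β) i / 2) ^ 2) with hh
  have hcosh : Measurable fun β : Fin p → ℝ => fun i => Real.cosh ((U *ᵥ β) i / 2) :=
    measurable_pi_lambda _ fun i => Real.continuous_cosh.measurable.comp (by
      simp only [mulVec, dotProduct]
      fun_prop)
  have hcosh_i (i : Fin n) : Measurable fun β : Fin p → ℝ => Real.cosh ((U *ᵥ β) i / 2) :=
    (measurable_pi_apply i).comp hcosh
  have hH_meas : Measurable H := by fun_prop
  have hh_meas : Measurable h := by fun_prop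
  have hHh (β : Fin p → ℝ) : H β ≤ h β := by
    refine ENNReal.ofReal_le_ofReal (Finset.prod_le_prod (fun i _ => (Real.cosh_pos _).le)
      fun i _ => ?_)
    exact le_self_pow₀ (Real.one_le_cosh _) two_ne_zero
  have hk_meas : Measurable (Function.uncurry k) := by
    have e : Function.uncurry k = fun a : (Fin p → ℝ) × (Fin p → ℝ) => ∫⁻ w,
        ENNReal.ofReal (pswNormalDensity U B b y a.2 w * pswPGDensity U gt w a.1)
          ∂(pswWMeasure n) := funext fun a => hk a.1 a.2
    rw [e]
    exact measurable_lintegral_psw_transition hgt_meas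
  have hk_one (βt : Fin p → ℝ) : ∫⁻ β, k βt β ≤ 1 := by
    simpa [hk] using lintegral_mul_psw_transition_le (U := U) (b := b) (y := y) (M := 1)
      hgt_meas hgt_nonneg hgt_laplace (measurable_const (a := (1 : ℝ≥0∞)))
      (fun w hw => by simpa using (lintegral_pswNormalDensity hB hw).le) βt
  have hkh (βt : Fin p → ℝ) : ∫⁻ β, h β * k βt β ≤ M := by
    simp_rw [hk]
    exact lintegral_mul_psw_transition_le hgt_meas hgt_nonneg hgt_laplace hh_meas hMle βt
  have hq_one : ∫⁻ β, q 0 β ≤ 1 := by simp_rw [hq_zero]; exact hq₀_prob.le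
  have hq_meas : Measurable (q 0) := by
    rw [funext hq_zero]
    fun_prop
  have hqH : ∫⁻ β, H β * q 0 β ≠ ⊤ := by
    simp_rw [hq_zero]
    exact (lintegral_prod_cosh_mul_lt_top hq₀_nonneg hq₀_exp).ne
  set K : ℝ := (c * (2 ^ n * B.det ^ ((1 : ℝ) / 2) * Real.exp (1/2 * (b ⬝ᵥ B⁻¹ *ᵥ b)))) ^ 2
    with hK
  have hD (βt β : Fin p → ℝ) : ∫⁻ w, ENNReal.ofReal
      ((pswNormalDensity U B b y β w / (pswPrior B b β * pswLik U y β / c)) ^ 2 *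
        pswPGDensity U gt w βt) ∂(pswWMeasure n) ≤ ENNReal.ofReal K * C * H βt * h β := by
    have hA : 0 ≤ K * ∏ i, Real.cosh ((U *ᵥ β) i / 2) ^ 2 := by positivity
    calc _ ≤ ∫⁻ w, ENNReal.ofReal (K * ∏ i, Real.cosh ((U *ᵥ β) i / 2) ^ 2) * ENNReal.ofReal
            ((pswPrec U B w).det * pswPGDensity U gt w βt) ∂(pswWMeasure n) := by
          refine lintegral_mono_ae ?_
          filter_upwards [ae_pswWMeasure_pos] with w hw
          rw [← ENNReal.ofReal_mul hA, ← mul_assoc]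
          refine ENNReal.ofReal_le_ofReal (mul_le_mul_of_nonneg_right ?_
            (pswPGDensity_nonneg hgt_nonneg hw βt))
          exact sq_pswNormalDensity_div_le hB hy (fun i => (hw i).le) hc_pos β
      _ ≤ ENNReal.ofReal (K * ∏ i, Real.cosh ((U *ᵥ β) i / 2) ^ 2) * (C * H βt) := by
          rw [lintegral_const_mul' _ _ ENNReal.ofReal_ne_top]
          gcongr
          exact hCle βt
      _ = _ := by
          rw [ENNReal.ofReal_mul (sq_nonneg _)]
          ring
  refine ⟨(ENNReal.ofReal K * C * (M * max M (∫⁻ β, H β * q 0 β))).toReal, fun j j' hj => ?_⟩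
  rw [ENNReal.ofReal_toReal (ENNReal.mul_ne_top (ENNReal.mul_ne_top ENNReal.ofReal_ne_top hC)
    (ENNReal.mul_ne_top hM (max_lt hM.lt_top hqH.lt_top).ne))]
  exact markov_lintegral_two_time_le hk_meas hkiter_one hkiter_succ hq_meas hq_succ hh_meas
    hH_meas hHh hk_one hkh hq_one le_rfl hD hj
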